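/- Fix q ∈ (0,1) and set ℘₊ := −e₁/5 + (1/10)·√(24 e₁² + 10 g₂). Then the chain of strict inequalities e₃ < e₂ < ℘₊ < e₁ holds. -/

import Mathlib

/-- `W_q(z)`: the Weierstrass ℘-function with periods `2π` and `-2i log q`,
evaluated at `-i log z`, as an explicit series. -/
noncomputable def W (q z : ℝ) : ℝ :=
  -1 / 12 - z / (1 - z) ^ 2 + 2 * ∑' n : ℕ, q ^ (2 * (n + 1)) / (1 - q ^ (2 * (n + 1))) ^ 2
    - ∑' n : ℕ, z * q ^ (2 * (n + 1)) / (1 - z * q ^ (2 * (n + 1))) ^ 2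
    - ∑' n : ℕ, (q ^ (2 * (n + 1)) / z) / (1 - q ^ (2 * (n + 1)) / z) ^ 2

noncomputable def e1 (q : ℝ) : ℝ := W q (-1)
noncomputable def e2 (q : ℝ) : ℝ := W q (-q)
noncomputable def e3 (q : ℝ) : ℝ := W q q
noncomputable def g2 (q : ℝ) : ℝ := 2 * (e1 q ^ 2 + e2 q ^ 2 + e3 q ^ 2)

/-- The Koebe function `x / (1 - x)²`. -/
noncomputable def koebe (x : ℝ) : ℝ := x / (1 - x) ^ 2

lemma hasSum_koebe {x : ℝ} (hx : |x| < 1) : HasSum (fun n : ℕ => (n : ℝ) * x ^ n) (koebe x) :=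
  hasSum_coe_mul_geometric_of_norm_lt_one hx

lemma koebe_pos {x : ℝ} (h0 : 0 < x) (h1 : x < 1) : 0 < koebe x :=
  div_pos h0 (pow_pos (by linarith) 2)

lemma koebe_neg_nonpos {x : ℝ} (h0 : 0 ≤ x) : koebe (-x) ≤ 0 :=
  div_nonpos_of_nonpos_of_nonneg (by linarith) (sq_nonneg _)

lemma neg_le_koebe_neg {x : ℝ} (h0 : 0 ≤ x) : -x ≤ koebe (-x) := by
  unfold koebe
  rw [le_div_iff₀ (by nlinarith)]
  nlinarith [mul_nonneg h0 h0, mul_nonneg h0 (mul_nonneg h0 h0)]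

lemma koebe_add_koebe_neg {x : ℝ} (h : |x| < 1) : koebe x + koebe (-x) = 4 * koebe (x ^ 2) := by
  obtain ⟨h1, h2⟩ := abs_lt.1 h
  have a : 1 - x ≠ 0 := by linarith
  have b : 1 + x ≠ 0 := by linarith
  have c : 1 - x ^ 2 ≠ 0 := by
    rw [show 1 - x ^ 2 = (1 - x) * (1 + x) by ring]; exact mul_ne_zero a b
  have d : koebe (x ^ 2) = x ^ 2 / ((1 - x) * (1 + x)) ^ 2 := by unfold koebe; congr 2; ring
  rw [d]
  unfold koebe
  rw [sub_neg_eq_add]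
  field_simp
  ring

lemma summable_koebe {ι : Type*} {u : ι → ℝ} {r : ℝ} (hr : r < 1) (hu : Summable fun i => |u i|)
    (h : ∀ i, |u i| ≤ r) : Summable fun i => koebe (u i) := by
  refine Summable.of_norm_bounded (hu.mul_right ((1 - r) ^ 2)⁻¹) fun i => ?_
  have h2 : 1 - r ≤ |1 - u i| := le_trans (by linarith [h i, le_abs_self (u i)]) (le_abs_self _)
  have h3 : (1 - r) ^ 2 ≤ (1 - u i) ^ 2 := by
    rw [← sq_abs (1 - u i)]
    exact pow_le_pow_left₀ (by linarith) h2 2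
  have h4 : 0 < (1 - r) ^ 2 := pow_pos (by linarith) 2
  rw [koebe, Real.norm_eq_abs, abs_div, abs_of_nonneg (sq_nonneg (1 - u i)), div_eq_mul_inv]
  gcongr

section Koebe

variable {q : ℝ}

lemma summable_pow_comp (h0 : 0 < q) (h1 : q < 1) {k : ℕ → ℕ} (hk : ∀ n, n ≤ k n) :
    Summable fun n => q ^ k n :=
  Summable.of_nonneg_of_le (fun n => by positivity)
    (fun n => pow_le_pow_of_le_one h0.le h1.le (hk n)) (summable_geometric_of_lt_one h0.le h1)

lemma summable_koebe_pow (h0 : 0 < q) (h1 : q < 1) {k : ℕ → ℕ} (hk : ∀ n, n < k n) :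
    Summable fun n => koebe (q ^ k n) := by
  have h (n : ℕ) : |q ^ k n| = q ^ k n := abs_of_nonneg (by positivity)
  refine summable_koebe h1 ?_ fun n => ?_
  · simpa only [h] using summable_pow_comp h0 h1 fun n => (hk n).le
  · rw [h]
    exact pow_le_of_le_one h0.le h1.le (by have := hk n; omega)

lemma summable_koebe_neg_pow (h0 : 0 < q) (h1 : q < 1) {k : ℕ → ℕ} (hk : ∀ n, n < k n) :
    Summable fun n => koebe (-q ^ k n) := by
  have h (n : ℕ) : |-q ^ k n| = q ^ k n := by rw [abs_neg]; exact abs_of_nonneg (by positivity)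
  refine summable_koebe h1 ?_ fun n => ?_
  · simpa only [h] using summable_pow_comp h0 h1 fun n => (hk n).le
  · rw [h]
    exact pow_le_of_le_one h0.le h1.le (by have := hk n; omega)

lemma e1_eq_koebe (q : ℝ) : e1 q = 1 / 6 + 2 * ∑' n : ℕ, koebe (q ^ (2 * n + 2))
    - 2 * ∑' n : ℕ, koebe (-q ^ (2 * n + 2)) := by
  simp only [e1, W, koebe, neg_one_mul, div_neg, div_one, mul_add, mul_one]
  ring

lemma e3_eq_koebe (h0 : 0 < q) (h1 : q < 1) : e3 q = -1 / 12
    + 2 * ∑' n : ℕ, koebe (q ^ (2 * n + 2)) - 2 * ∑' n : ℕ, koebe (q ^ (2 * n + 1)) := by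
  have hs := summable_koebe_pow h0 h1 (k := fun n => 2 * n + 1) (by intro n; omega)
  have h := hs.tsum_eq_zero_add
  have hl (n : ℕ) : q ^ (2 * (n + 1)) / q = q ^ (2 * n + 1) := by
    field_simp; ring
  have hr (n : ℕ) : q * q ^ (2 * (n + 1)) = q ^ (2 * (n + 1) + 1) := by ring
  simp only [e3, W, hl, hr]
  simp only [koebe, mul_zero, zero_add, pow_one] at h ⊢
  simp only [mul_add, mul_one] at h ⊢
  linarith

lemma e2_eq_koebe (h0 : 0 < q) (h1 : q < 1) : e2 q = -1 / 12
    + 2 * ∑' n : ℕ, koebe (q ^ (2 * n + 2)) - 2 * ∑' n : ℕ, koebe (-q ^ (2 * n + 1)) := by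
  have hs := summable_koebe_neg_pow h0 h1 (k := fun n => 2 * n + 1) (by intro n; omega)
  have h := hs.tsum_eq_zero_add
  have hl (n : ℕ) : q ^ (2 * (n + 1)) / -q = -q ^ (2 * n + 1) := by
    field_simp; ring
  have hr (n : ℕ) : -q * q ^ (2 * (n + 1)) = -q ^ (2 * (n + 1) + 1) := by ring
  simp only [e2, W, hl, hr]
  simp only [koebe, mul_zero, zero_add, pow_one] at h ⊢
  simp only [mul_add, mul_one] at h ⊢
  linarith

lemma e1_add_e2_add_e3 (h0 : 0 < q) (h1 : q < 1) : e1 q + e2 q + e3 q = 0 := by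
  have sp (k : ℕ → ℕ) (hk : ∀ n, n < k n) := summable_koebe_pow h0 h1 hk
  have sn (k : ℕ → ℕ) (hk : ∀ n, n < k n) := summable_koebe_neg_pow h0 h1 hk
  have key (k : ℕ → ℕ) (hk : ∀ n, n < k n) :
      ∑' n, koebe (q ^ k n) + ∑' n, koebe (-q ^ k n) = 4 * ∑' n, koebe (q ^ (2 * k n)) := by
    rw [← (sp k hk).tsum_add (sn k hk), ← tsum_mul_left]
    refine tsum_congr fun n => ?_
    have : |q ^ k n| < 1 := by
      rw [abs_of_nonneg (by positivity)]
      exact pow_lt_one₀ h0.le h1 (by have := hk n; omega)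
    rw [koebe_add_koebe_neg this, ← pow_mul, mul_comm 2]
  have hodd := key (fun n => 2 * n + 1) (by intro n; omega)
  have heven := key (fun n => 2 * n + 2) (by intro n; omega)
  have hsplit := tsum_even_add_odd (f := fun n => koebe (q ^ (2 * n + 2)))
    (sp (fun n => 2 * (2 * n) + 2) (by intro n; omega))
    (sp (fun n => 2 * (2 * n + 1) + 2) (by intro n; omega))
  have h4 (n : ℕ) : 2 * (2 * n + 2) = 2 * (2 * n + 1) + 2 := by ring
  have h2 (n : ℕ) : 2 * (2 * n + 1) = 2 * (2 * n) + 2 := by ring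
  simp only [h4] at heven
  simp only [h2] at hodd heven hsplit
  rw [e1_eq_koebe, e2_eq_koebe h0 h1, e3_eq_koebe h0 h1]
  linarith

lemma e3_lt_e2 (h0 : 0 < q) (h1 : q < 1) : e3 q < e2 q := by
  have hlt : ∑' n : ℕ, koebe (-q ^ (2 * n + 1)) < ∑' n : ℕ, koebe (q ^ (2 * n + 1)) := by
    have h (n : ℕ) : koebe (-q ^ (2 * n + 1)) < koebe (q ^ (2 * n + 1)) :=
      (koebe_neg_nonpos (by positivity)).trans_lt
        (koebe_pos (by positivity) (pow_lt_one₀ h0.le h1 (by omega)))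
    exact Summable.tsum_lt_tsum (fun n => (h n).le) (h 0)
      (summable_koebe_neg_pow h0 h1 (by intro n; omega))
      (summable_koebe_pow h0 h1 (by intro n; omega))
  rw [e2_eq_koebe h0 h1, e3_eq_koebe h0 h1]
  linarith

end Koebe

lemma wp_plus_between_of_lt {a b c : ℝ} (hsum : a + b + c = 0) (hcb : c < b) (hba : b < a) :
    b < -a / 5 + 1 / 10 * √(24 * a ^ 2 + 10 * (2 * (a ^ 2 + b ^ 2 + c ^ 2))) ∧
    -a / 5 + 1 / 10 * √(24 * a ^ 2 + 10 * (2 * (a ^ 2 + b ^ 2 + c ^ 2))) < a := by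
  obtain rfl : c = -a - b := by linarith
  have ha : 0 < a := by linarith
  constructor
  · have : 10 * b + 2 * a < √(24 * a ^ 2 + 10 * (2 * (a ^ 2 + b ^ 2 + (-a - b) ^ 2))) := by
      apply Real.lt_sqrt_of_sq_lt
      nlinarith
    linarith
  · have : √(24 * a ^ 2 + 10 * (2 * (a ^ 2 + b ^ 2 + (-a - b) ^ 2))) < 12 * a := by
      rw [Real.sqrt_lt' (by linarith)]
      nlinarith
    linarith

section IntSums

lemma tsum_int_eq_zero_add {f : ℤ → ℝ} (hf : Summable f) :
    ∑' n, f n = f 0 + ∑' n : ℕ, (f (n + 1) + f (-(n + 1))) := by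
  have h := tsum_nat_add_neg hf
  rw [hf.nat_add_neg.tsum_eq_zero_add] at h
  push_cast at h
  rw [neg_zero] at h
  linarith

/-- The bijection `(d, n) ↦ (n, n + d)` of `ℤ × ℤ`. -/
def shearEquiv : ℤ × ℤ ≃ ℤ × ℤ where
  toFun p := (p.2, p.2 + p.1)
  invFun p := (p.2 - p.1, p.1)
  left_inv p := by simp
  right_inv p := by simp

variable {f g : ℤ → ℝ}

lemma summable_mul_shear (hf : Summable f) (hg : Summable g) :
    Summable fun p : ℤ × ℤ => f p.2 * g (p.2 + p.1) :=
  shearEquiv.summable_iff.2 (summable_mul_of_summable_norm hf.norm hg.norm)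

lemma summable_correlation (hf : Summable f) (hg : Summable g) :
    Summable fun d : ℤ => ∑' n, f n * g (n + d) :=
  (summable_mul_shear hf hg).prod

lemma summable_mul_add (hf : Summable f) (hg : Summable g) (d : ℤ) :
    Summable fun n => f n * g (n + d) :=
  (summable_mul_shear hf hg).prod_factor d

lemma tsum_mul_tsum_eq_tsum_correlation (hf : Summable f) (hg : Summable g) :
    (∑' n, f n) * ∑' n, g n = ∑' d : ℤ, ∑' n, f n * g (n + d) := by
  rw [tsum_mul_tsum_of_summable_norm hf.norm hg.norm, ← shearEquiv.tsum_eq]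
  exact (summable_mul_shear hf hg).tsum_prod

end IntSums

/-- `sech (n * t)` for `q = exp (-t)`. -/
noncomputable def sechPow (q : ℝ) (n : ℤ) : ℝ := 2 * q ^ n / (1 + (q ^ n) ^ 2)

/-- `1 + tanh (n * t)` for `q = exp (-t)`. -/
noncomputable def tanhPow (q : ℝ) (n : ℤ) : ℝ := 2 / (1 + (q ^ n) ^ 2)

section SechPow

variable {q : ℝ}

lemma sechPow_neg (h0 : 0 < q) (n : ℤ) : sechPow q (-n) = sechPow q n := by
  have : 0 < q ^ n := zpow_pos h0 n
  rw [sechPow, sechPow, zpow_neg]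
  field_simp
  ring

lemma sechPow_zero (q : ℝ) : sechPow q 0 = 1 := by norm_num [sechPow]

lemma sechPow_pos (h0 : 0 < q) (n : ℤ) : 0 < sechPow q n := by
  have : 0 < q ^ n := zpow_pos h0 n
  unfold sechPow
  positivity

lemma summable_sechPow (h0 : 0 < q) (h1 : q < 1) : Summable (sechPow q) := by
  have h : Summable fun n : ℕ => sechPow q n := by
    refine Summable.of_nonneg_of_le (fun n => (sechPow_pos h0 n).le) (fun n => ?_)
      ((summable_geometric_of_lt_one h0.le h1).mul_left 2)
    rw [sechPow, zpow_natCast]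
    exact div_le_self (by positivity) (by nlinarith [sq_nonneg (q ^ n)])
  exact Summable.of_nat_of_neg h (by simpa only [sechPow_neg h0] using h)

lemma summable_neg_one_zpow_mul {f : ℤ → ℝ} (hf : Summable f) :
    Summable fun n : ℤ => (-1 : ℝ) ^ n * f n := by
  refine Summable.of_norm_bounded hf.norm fun n => ?_
  simp

lemma sechPow_mul_sechPow_add (h0 : 0 < q) (h1 : q < 1) {d : ℤ} (hd : 0 < d) (n : ℤ) :
    sechPow q n * sechPow q (n + d) =
      2 * q ^ d / (1 - (q ^ d) ^ 2) * (tanhPow q (n + d) - tanhPow q n) := by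
  have hx : 0 < q ^ n := zpow_pos h0 n
  have hy : 0 < q ^ d := zpow_pos h0 d
  have hy1 : q ^ d < 1 := zpow_lt_one₀ h0 h1 hd
  have : 1 - (q ^ d) ^ 2 ≠ 0 := by nlinarith
  rw [sechPow, sechPow, tanhPow, tanhPow, zpow_add₀ h0.ne']
  generalize q ^ n = x at *
  generalize q ^ d = y at *
  field_simp
  ring

lemma summable_tanhPow_succ_sub (h0 : 0 < q) (h1 : q < 1) :
    Summable fun n : ℤ => tanhPow q (n + 1) - tanhPow q n := by
  have h := summable_mul_add (summable_sechPow h0 h1) (summable_sechPow h0 h1) 1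
  simp only [sechPow_mul_sechPow_add h0 h1 one_pos] at h
  have hne : 2 * q ^ (1 : ℤ) / (1 - (q ^ (1 : ℤ)) ^ 2) ≠ 0 := by
    rw [zpow_one]
    exact div_ne_zero (by positivity) (by nlinarith)
  exact (summable_mul_left_iff hne).1 h

lemma tanhPow_add_sub_eq_sum (q : ℝ) (d : ℕ) (n : ℤ) : tanhPow q (n + d) - tanhPow q n =
    ∑ i ∈ Finset.range d, (tanhPow q (n + i + 1) - tanhPow q (n + i)) := by
  have h := Finset.sum_range_sub (fun i : ℕ => tanhPow q (n + i)) d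
  push_cast at h
  simpa only [add_zero, ← add_assoc] using h.symm

lemma tsum_tanhPow_succ_sub (h0 : 0 < q) (h1 : q < 1) :
    ∑' n : ℤ, (tanhPow q (n + 1) - tanhPow q n) = 2 := by
  have hs := summable_tanhPow_succ_sub h0 h1
  have hq : Filter.Tendsto (fun n : ℕ => q ^ n) Filter.atTop (nhds 0) :=
    tendsto_pow_atTop_nhds_zero_of_lt_one h0.le h1
  have h := hs.hasSum.nat_add_neg_add_one
  refine tendsto_nhds_unique h.tendsto_sum_nat ?_
  have hsum (N : ℕ) : ∑ n ∈ Finset.range N, (tanhPow q ((n : ℤ) + 1) - tanhPow q n +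
      (tanhPow q (-((n : ℤ) + 1) + 1) - tanhPow q (-((n : ℤ) + 1)))) =
      tanhPow q N - tanhPow q (-N) := by
    induction N with
    | zero => simp
    | succ N ih =>
      rw [Finset.sum_range_succ, ih, show -((N : ℤ) + 1) + 1 = -N by ring]
      push_cast
      ring
  simp only [hsum]
  have heq (N : ℕ) : tanhPow q N - tanhPow q (-N) =
      2 * (1 - (q ^ N) ^ 2) / (1 + (q ^ N) ^ 2) := by
    have : 0 < q ^ N := by positivity
    rw [tanhPow, tanhPow, zpow_neg, zpow_natCast]
    field_simp
    ring
  simp only [heq]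
  have : Filter.Tendsto (fun N : ℕ => 2 * (1 - (q ^ N) ^ 2) / (1 + (q ^ N) ^ 2)) Filter.atTop
      (nhds (2 * (1 - 0 ^ 2) / (1 + 0 ^ 2))) :=
    ((hq.pow 2).const_sub 1 |>.const_mul 2).div ((hq.pow 2).const_add 1) (by norm_num)
  simpa using this

lemma tsum_sechPow_mul_add (h0 : 0 < q) (h1 : q < 1) {d : ℕ} (hd : 0 < d) :
    ∑' n : ℤ, sechPow q n * sechPow q (n + d) = 4 * (d * q ^ d / (1 - (q ^ d) ^ 2)) := by
  have hs := summable_tanhPow_succ_sub h0 h1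
  have hsi (i : ℤ) := (Equiv.addRight i).summable_iff.2 hs
  have hti (i : ℤ) := (Equiv.addRight i).tsum_eq fun n : ℤ => tanhPow q (n + 1) - tanhPow q n
  simp only [Function.comp_def, Equiv.coe_addRight] at hsi hti
  simp only [sechPow_mul_sechPow_add h0 h1 (Int.natCast_pos.2 hd), tsum_mul_left,
    tanhPow_add_sub_eq_sum]
  rw [Summable.tsum_finsetSum fun (i : ℕ) _ => hsi i]
  simp only [hti, tsum_tanhPow_succ_sub h0 h1, Finset.sum_const, Finset.card_range, nsmul_eq_mul,
    zpow_natCast]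
  ring

lemma neg_one_zpow_mul_self (n : ℤ) : (-1 : ℝ) ^ n * (-1) ^ n = 1 := by
  rw [← mul_zpow]; norm_num

lemma tsum_alternating_sechPow_mul_add_eq_zero (h0 : 0 < q) (h1 : q < 1) {d : ℕ} (hd : 0 < d)
    (he : Even d) : ∑' n : ℤ, (-1 : ℝ) ^ n * sechPow q n * sechPow q (n + d) = 0 := by
  set b : ℤ → ℝ := fun n => (-1 : ℝ) ^ n * (tanhPow q (n + 1) - tanhPow q n) with hb
  have hs : Summable b := summable_neg_one_zpow_mul (summable_tanhPow_succ_sub h0 h1)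
  have hsi (i : ℤ) : Summable fun n => (-1 : ℝ) ^ i * b (n + i) :=
    ((Equiv.addRight i).summable_iff.2 hs).mul_left _
  have hti (i : ℤ) : ∑' n, b (n + i) = ∑' n, b n := (Equiv.addRight i).tsum_eq b
  have hterm (n : ℤ) : (-1 : ℝ) ^ n * sechPow q n * sechPow q (n + d) =
      2 * q ^ (d : ℤ) / (1 - (q ^ (d : ℤ)) ^ 2) *
        ∑ i ∈ Finset.range d, (-1 : ℝ) ^ (i : ℤ) * b (n + i) := by
    rw [mul_assoc, sechPow_mul_sechPow_add h0 h1 (Int.natCast_pos.2 hd), mul_left_comm,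
      tanhPow_add_sub_eq_sum, Finset.mul_sum]
    congr 1
    refine Finset.sum_congr rfl fun i _ => ?_
    rw [hb]
    simp only
    rw [zpow_add₀ (by norm_num), ← mul_assoc, mul_left_comm, neg_one_zpow_mul_self, mul_one]
  simp only [hterm, tsum_mul_left]
  rw [Summable.tsum_finsetSum fun (i : ℕ) _ => hsi i]
  simp only [tsum_mul_left, hti, ← Finset.sum_mul, zpow_natCast, neg_one_geom_sum, if_pos he,
    zero_mul, mul_zero]

/-- The alternating Lambert series `1/8 + ∑ (-1)ⁿ qⁿ / (1 + qⁿ)²`. -/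
noncomputable def altLambert (q : ℝ) : ℝ := 1 / 8 - ∑' n : ℕ, koebe (-q ^ (2 * n + 2))
    + ∑' n : ℕ, koebe (-q ^ (2 * n + 1))

lemma sechPow_natCast_mul_self (q : ℝ) (n : ℕ) :
    sechPow q n * sechPow q n = -(4 * koebe (-q ^ (2 * n))) := by
  rw [sechPow, koebe, zpow_natCast, pow_mul' q 2 n, sub_neg_eq_add]
  field_simp
  ring

lemma tsum_tsum_mul_pow_odd (h0 : 0 < q) (h1 : q < 1) :
    ∑' d : ℕ, (-1 : ℝ) ^ (d + 1) * ((d + 1 : ℕ) * q ^ (d + 1) / (1 - (q ^ (d + 1)) ^ 2)) =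
      ∑' n : ℕ, koebe (-q ^ (2 * n + 1)) := by
  set F : ℕ → ℕ → ℝ := fun d n => (d + 1 : ℕ) * (-q ^ (2 * n + 1)) ^ (d + 1) with hF
  have hlt {k : ℕ} (hk : k ≠ 0) : q ^ k < 1 := pow_lt_one₀ h0.le h1 hk
  have hsum : Summable (Function.uncurry F) := by
    have ha : Summable fun d : ℕ => ((d + 1 : ℕ) : ℝ) * q ^ (d + 1) :=
      (summable_nat_add_iff 1).2 (hasSum_koebe (abs_lt.2 ⟨by linarith, h1⟩)).summable
    have hb : Summable fun n : ℕ => (q ^ 2) ^ n :=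
      summable_geometric_of_lt_one (by positivity) (hlt (by norm_num))
    refine Summable.of_norm_bounded (summable_mul_of_summable_norm ha.norm hb.norm) ?_
    rintro ⟨d, n⟩
    simp only [Function.uncurry, hF, norm_mul, norm_pow, norm_neg, Real.norm_eq_abs,
      abs_of_pos h0, Nat.abs_cast, mul_assoc]
    gcongr
    rw [← pow_mul, ← pow_mul, ← pow_add]
    exact pow_le_pow_of_le_one h0.le h1.le (by nlinarith)
  have hcol (n : ℕ) : ∑' d, F d n = koebe (-q ^ (2 * n + 1)) := by
    have h : |-q ^ (2 * n + 1)| < 1 := by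
      rw [abs_neg, abs_of_pos (by positivity)]; exact hlt (by omega)
    have := hasSum_koebe h
    rw [← this.tsum_eq, this.summable.tsum_eq_zero_add]
    simp [hF]
  have hrow (d : ℕ) : ∑' n, F d n =
      (-1 : ℝ) ^ (d + 1) * ((d + 1 : ℕ) * q ^ (d + 1) / (1 - (q ^ (d + 1)) ^ 2)) := by
    have h (n : ℕ) : F d n =
        (-1 : ℝ) ^ (d + 1) * ((d + 1 : ℕ) * q ^ (d + 1)) * ((q ^ (d + 1)) ^ 2) ^ n := by
      simp only [hF]
      rw [neg_pow]
      ring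
    simp only [h]
    rw [tsum_mul_left, tsum_geometric_of_lt_one (by positivity)
      (pow_lt_one₀ (by positivity) (hlt (by omega)) (by norm_num))]
    ring
  rw [← tsum_congr hcol, ← tsum_congr hrow]
  exact hsum.tsum_comm.symm

lemma tsum_alternating_sechPow_sq (h0 : 0 < q) (h1 : q < 1) :
    (∑' n : ℤ, (-1 : ℝ) ^ n * sechPow q n) ^ 2 = 8 * altLambert q := by
  have hs := summable_sechPow h0 h1
  have hs' := summable_neg_one_zpow_mul hs
  rw [sq, tsum_mul_tsum_eq_tsum_correlation hs' hs',
    tsum_int_eq_zero_add (summable_correlation hs' hs')]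
  have hterm (d : ℤ) : ∑' n : ℤ, (-1 : ℝ) ^ n * sechPow q n * ((-1) ^ (n + d) * sechPow q (n + d))
      = (-1) ^ d * ∑' n : ℤ, sechPow q n * sechPow q (n + d) := by
    rw [← tsum_mul_left]
    refine tsum_congr fun n => ?_
    rw [zpow_add₀ (by norm_num)]
    linear_combination ((-1) ^ d * sechPow q n * sechPow q (n + d)) * neg_one_zpow_mul_self n
  have hneg (d : ℤ) : ∑' n : ℤ, sechPow q n * sechPow q (n + -d) =
      ∑' n : ℤ, sechPow q n * sechPow q (n + d) := by
    rw [← (Equiv.addRight d).tsum_eq]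
    simp [mul_comm]
  have hcast (d : ℕ) : (d : ℤ) + 1 = ((d + 1 : ℕ) : ℤ) := by push_cast; rfl
  have hzero : ∑' n : ℤ, sechPow q n * sechPow q n =
      1 - 8 * ∑' n : ℕ, koebe (-q ^ (2 * n + 2)) := by
    rw [tsum_int_eq_zero_add (by simpa using summable_mul_add hs hs 0)]
    simp only [sechPow_neg h0, hcast, sechPow_natCast_mul_self, sechPow_zero, ← two_mul,
      tsum_neg, tsum_mul_left, mul_add, mul_one]
    ring
  simp only [hterm, zpow_neg, hneg]
  simp only [add_zero, zpow_zero, one_mul, hzero]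
  have hpos (d : ℕ) : (-1 : ℝ) ^ ((d : ℤ) + 1) * ∑' n : ℤ, sechPow q n * sechPow q (n + (d + 1)) +
      ((-1 : ℝ) ^ ((d : ℤ) + 1))⁻¹ * ∑' n : ℤ, sechPow q n * sechPow q (n + (d + 1)) =
      8 * ((-1 : ℝ) ^ (d + 1) * ((d + 1 : ℕ) * q ^ (d + 1) / (1 - (q ^ (d + 1)) ^ 2))) := by
    rw [hcast, tsum_sechPow_mul_add h0 h1 (Nat.add_one_pos d), zpow_natCast, ← inv_pow,
      inv_neg, inv_one]
    ring
  simp only [hpos]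
  rw [tsum_mul_left, tsum_tsum_mul_pow_odd h0 h1, altLambert]
  ring

lemma tsum_sechPow_mul_tsum_alternating (h0 : 0 < q) (h1 : q < 1) :
    (∑' n : ℤ, (-1 : ℝ) ^ n * sechPow q n) * ∑' n : ℤ, sechPow q n = 8 * altLambert (q ^ 2) := by
  have hs := summable_sechPow h0 h1
  have hs' := summable_neg_one_zpow_mul hs
  rw [tsum_mul_tsum_eq_tsum_correlation hs' hs,
    tsum_int_eq_zero_add (summable_correlation hs' hs)]
  have hneg (d : ℤ) : ∑' n : ℤ, (-1 : ℝ) ^ n * sechPow q n * sechPow q (n + -d) =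
      (-1) ^ d * ∑' n : ℤ, (-1 : ℝ) ^ n * sechPow q n * sechPow q (n + d) := by
    rw [← (Equiv.addRight d).tsum_eq, ← tsum_mul_left]
    refine tsum_congr fun n => ?_
    simp only [Equiv.coe_addRight, add_neg_cancel_right]
    rw [zpow_add₀ (by norm_num)]
    ring
  have hcast (d : ℕ) : (d : ℤ) + 1 = ((d + 1 : ℕ) : ℤ) := by push_cast; rfl
  have hpair (d : ℕ) : ∑' n : ℤ, (-1 : ℝ) ^ n * sechPow q n * sechPow q (n + (d + 1)) +
      ∑' n : ℤ, (-1 : ℝ) ^ n * sechPow q n * sechPow q (n + -(d + 1)) = 0 := by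
    rw [hneg, hcast, zpow_natCast]
    rcases Nat.even_or_odd (d + 1) with he | ho
    · rw [tsum_alternating_sechPow_mul_add_eq_zero h0 h1 d.succ_pos he]
      ring
    · rw [ho.neg_one_pow]
      ring
  have hsq : Summable fun n : ℤ => (-1 : ℝ) ^ n * sechPow q n * sechPow q n := by
    simpa using summable_mul_add hs' hs 0
  simp only [hpair, tsum_zero, add_zero]
  rw [tsum_int_eq_zero_add hsq]
  have hterm (n : ℕ) : (-1 : ℝ) ^ ((n : ℤ) + 1) * sechPow q (n + 1) * sechPow q (n + 1) +
      (-1 : ℝ) ^ (-((n : ℤ) + 1)) * sechPow q (-(n + 1)) * sechPow q (-(n + 1)) =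
      8 * ((-1) ^ n * koebe (-(q ^ 2) ^ (n + 1))) := by
    rw [sechPow_neg h0, hcast, mul_assoc, mul_assoc, sechPow_natCast_mul_self, zpow_neg,
      zpow_natCast, ← inv_pow, inv_neg, inv_one, pow_mul]
    ring
  have hsk (k : ℕ → ℕ) (hk : ∀ n, n < k n) : Summable fun n => koebe (-(q ^ 2) ^ k n) :=
    summable_koebe_neg_pow (by positivity) (pow_lt_one₀ h0.le h1 (by norm_num)) hk
  have hpar := tsum_even_add_odd (f := fun n => (-1 : ℝ) ^ n * koebe (-(q ^ 2) ^ (n + 1)))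
    (by simpa using hsk (fun n => 2 * n + 1) (by intro n; omega))
    (by simpa [pow_succ (-1 : ℝ)] using (hsk (fun n => 2 * n + 1 + 1) (by intro n; omega)).neg)
  have he (n : ℕ) : (-1 : ℝ) ^ (2 * n) = 1 := by simp
  have ho (n : ℕ) : (-1 : ℝ) ^ (2 * n + 1) = -1 := by simp [pow_succ]
  simp only [he, ho, one_mul, neg_one_mul, tsum_neg] at hpar
  simp only [hterm, tsum_mul_left, ← hpar, altLambert, sechPow_zero]
  norm_num
  ring

lemma altLambert_nonneg (h0 : 0 < q) (h1 : q < 1) : 0 ≤ altLambert q := by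
  have := tsum_alternating_sechPow_sq h0 h1
  nlinarith [sq_nonneg (∑' n : ℤ, (-1 : ℝ) ^ n * sechPow q n)]

lemma altLambert_sq_eq_zero (h0 : 0 < q) (h1 : q < 1) (h : altLambert q = 0) :
    altLambert (q ^ 2) = 0 := by
  have hsq := tsum_alternating_sechPow_sq h0 h1
  rw [h, mul_zero, sq_eq_zero_iff] at hsq
  have := tsum_sechPow_mul_tsum_alternating h0 h1
  rw [hsq, zero_mul] at this
  linarith

lemma altLambert_pos_of_lt (h0 : 0 < q) (h : q < 1 / 10) : 0 < altLambert q := by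
  have h1 : q < 1 := by linarith
  have heven : ∑' n : ℕ, koebe (-q ^ (2 * n + 2)) ≤ 0 :=
    tsum_nonpos fun n => koebe_neg_nonpos (by positivity)
  have hgeo : HasSum (fun n : ℕ => -(q * (q ^ 2) ^ n)) (-(q * (1 - q ^ 2)⁻¹)) :=
    ((hasSum_geometric_of_lt_one (by positivity) (by nlinarith)).mul_left q).neg
  have hodd : -(q * (1 - q ^ 2)⁻¹) ≤ ∑' n : ℕ, koebe (-q ^ (2 * n + 1)) := by
    rw [← hgeo.tsum_eq]
    refine hgeo.summable.tsum_le_tsum (fun n => ?_)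
      (summable_koebe_neg_pow h0 h1 (by intro n; omega))
    rw [← pow_mul, ← pow_succ']
    exact neg_le_koebe_neg (by positivity)
  have hsmall : q * (1 - q ^ 2)⁻¹ < 1 / 8 := by
    rw [← div_eq_mul_inv, div_lt_iff₀ (by nlinarith)]
    nlinarith
  unfold altLambert
  linarith

lemma altLambert_pos (h0 : 0 < q) (h1 : q < 1) : 0 < altLambert q := by
  refine (altLambert_nonneg h0 h1).lt_of_ne' fun h => ?_
  have hz (k : ℕ) : altLambert (q ^ 2 ^ k) = 0 := by
    induction k with
    | zero => simpa using h
    | succ k ih =>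
      rw [pow_succ, pow_mul]
      exact altLambert_sq_eq_zero (by positivity) (pow_lt_one₀ h0.le h1 (by positivity)) ih
  obtain ⟨n, hn⟩ := exists_pow_lt_of_lt_one (show (0 : ℝ) < 1 / 10 by norm_num) h1
  have hlt : q ^ 2 ^ n < 1 / 10 :=
    (pow_le_pow_of_le_one h0.le h1.le Nat.lt_two_pow_self.le).trans_lt hn
  exact (altLambert_pos_of_lt (by positivity) hlt).ne' (hz n)

lemma e2_lt_e1 (h0 : 0 < q) (h1 : q < 1) : e2 q < e1 q := by
  have h := altLambert_pos h0 h1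
  unfold altLambert at h
  rw [e1_eq_koebe, e2_eq_koebe h0 h1]
  linarith

end SechPow

/-- With `℘₊ = -e₁/5 + (1/10)√(24 e₁² + 10 g₂)`, one has
`e₃ < e₂ < ℘₊ < e₁`. -/
theorem wp_plus_between (q : ℝ) (hq : q ∈ Set.Ioo (0 : ℝ) 1) :
    e3 q < e2 q ∧
    e2 q < -e1 q / 5 + (1 / 10) * Real.sqrt (24 * e1 q ^ 2 + 10 * g2 q) ∧
    -e1 q / 5 + (1 / 10) * Real.sqrt (24 * e1 q ^ 2 + 10 * g2 q) < e1 q := by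
  have h32 := e3_lt_e2 hq.1 hq.2
  exact ⟨h32, wp_plus_between_of_lt (e1_add_e2_add_e3 hq.1 hq.2) h32 (e2_lt_e1 hq.1 hq.2)⟩
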